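/- arXiv:2407.17921 — 2 statements merged into one kernel-verified Lean document; each statement's English description precedes it below -/
import Mathlib

section
/- Assume n ≥ 2. Each of the functions M_v (v ∈ V), Δ'_K (K ⊆ V nonempty independent), and X belongs to the ring H*(GQ_{2n−2}). Let P' be the polynomial ring over ℤ with one indeterminate x_v for each v ∈ V, one indeterminate y_K for each nonempty independent K ⊆ V, and one indeterminate z, and let ψ : P' → H*(GQ_{2n−2}) be the ℤ-algebra homomorphism determined by ψ(x_v) = M_v, ψ(y_K) = Δ'_K, ψ(z) = X. Let 𝔦' ⊆ P' be the ideal generated by: (i) ∏_{J∈𝔉} g_J for every finite family 𝔉 of subsets of V with empty intersection, where each J ∈ 𝔉 is either V∖{v} for some vertex v (with g_J := x_v) or a nonempty independent subset (with g_J := y_J); (ii) x_v + x_{v̄} − 2z for every v ∈ V; (iii) ∏_{i∈I} x_i − (y_{V∖(I∪{a})} + y_{V∖(I∪{ā})}) for every I ⊆ V with |I| = n−1 whose complement contains exactly one pair {a, ā}; (iv) y_K·x_i − y_{K∖{i}} for every independent K and i ∈ V with {i} ⊊ K. Then ψ is surjective with kernel 𝔦', so P'/𝔦' is isomorphic as a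 ring to H*(GQ_{2n−2}). -/
open MvPolynomial Finset

noncomputable section

abbrev Rr (n : ℕ) := MvPolynomial (Fin n) ℤ

/-- The "opposite" vertex: 0-indexed version of i ↦ 2n+1−i. -/
def bar {n : ℕ} (i : Fin (2*n)) : Fin (2*n) :=
  ⟨2*n - 1 - i.val, by have := i.isLt; omega⟩

/-- The weight α_i (0-indexed): α_i = X i for i < n, and α_i = −α_{bar i} otherwise. -/
def av {n : ℕ} (i : Fin (2*n)) : Rr n :=
  if h : i.val < n then X ⟨i.val, h⟩
  else - X ⟨2*n - 1 - i.val, by have := i.isLt; omega⟩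

/-- The axial function α(ij). -/
def ax {n : ℕ} (i j : Fin (2*n)) : Rr n :=
  if j = bar i then - av i else - av i + av j

/-- The class M_v. -/
def Mv {n : ℕ} (v : Fin (2*n)) : Fin (2*n) → Rr n := fun j =>
  if j = v then 0 else if j = bar v then 2 * av v else - av j + av v

/-- The class Q. -/
def Qf {n : ℕ} : Fin (2*n) → Rr n := fun j => - av j

/-- Independence: K contains no pair {i, bar i}. -/
def indep {n : ℕ} (K : Finset (Fin (2*n))) : Prop :=
  ∀ i : Fin (2*n), ¬ ({i, bar i} : Finset (Fin (2*n))) ⊆ K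

/-- The class Δ_K. -/
def Del {n : ℕ} (K : Finset (Fin (2*n))) : Fin (2*n) → Rr n := fun j =>
  if j ∈ K then ∏ k ∈ Kᶜ, ax j k else 0

/-- The class Δ'_K. -/
def Del' {n : ℕ} (K : Finset (Fin (2*n))) : Fin (2*n) → Rr n := fun j =>
  if j ∈ K then ∏ k ∈ (K ∪ {bar j})ᶜ, ax j k else 0

/-- The graph equivariant cohomology H*(GQ_{2n−1}) as a subring of the ring of
functions V → R with pointwise operations. -/
def HGQ (n : ℕ) : Subring (Fin (2*n) → Rr n) where
  carrier := {f | ∀ i j : Fin (2*n), i ≠ j → ax i j ∣ f i - f j}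
  zero_mem' := fun i j _ => by simp
  one_mem' := fun i j _ => by simp
  add_mem' := by
    intro a b ha hb i j h
    have e : (a + b) i - (a + b) j = (a i - a j) + (b i - b j) := by
      simp only [Pi.add_apply]; ring
    rw [e]; exact dvd_add (ha i j h) (hb i j h)
  neg_mem' := by
    intro a ha i j h
    have e : (-a) i - (-a) j = -(a i - a j) := by
      simp only [Pi.neg_apply]; ring
    rw [e]; exact dvd_neg.mpr (ha i j h)
  mul_mem' := by
    intro a b ha hb i j h
    have e : (a * b) i - (a * b) j = a i * (b i - b j) + (a i - a j) * b j := by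
      simp only [Pi.mul_apply]; ring
    rw [e]; exact dvd_add ((hb i j h).mul_left _) ((ha i j h).mul_right _)

/-- The graph equivariant cohomology H*(GQ_{2n−2}) (edges i j with j ≠ bar i only). -/
def HGQe (n : ℕ) : Subring (Fin (2*n) → Rr n) where
  carrier := {f | ∀ i j : Fin (2*n), i ≠ j → j ≠ bar i → ax i j ∣ f i - f j}
  zero_mem' := fun i j _ _ => by simp
  one_mem' := fun i j _ _ => by simp
  add_mem' := by
    intro a b ha hb i j h h'
    have e : (a + b) i - (a + b) j = (a i - a j) + (b i - b j) := by
      simp only [Pi.add_apply]; ring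
    rw [e]; exact dvd_add (ha i j h h') (hb i j h h')
  neg_mem' := by
    intro a ha i j h h'
    have e : (-a) i - (-a) j = -(a i - a j) := by
      simp only [Pi.neg_apply]; ring
    rw [e]; exact dvd_neg.mpr (ha i j h h')
  mul_mem' := by
    intro a b ha hb i j h h'
    have e : (a * b) i - (a * b) j = a i * (b i - b j) + (a i - a j) * b j := by
      simp only [Pi.mul_apply]; ring
    rw [e]; exact dvd_add ((hb i j h h').mul_left _) ((ha i j h h').mul_right _)


/-- Index type for the indeterminates of the polynomial ring P': one x_v per vertex v,
one y_K per nonempty independent subset K, and one z. -/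
abbrev IndepSet (n : ℕ) := {K : Finset (Fin (2*n)) // K.Nonempty ∧ indep K}

abbrev GenIdx (n : ℕ) := Fin (2*n) ⊕ IndepSet n ⊕ Unit

def xg {n : ℕ} (v : Fin (2*n)) : MvPolynomial (GenIdx n) ℤ := X (Sum.inl v)
def yg {n : ℕ} (K : IndepSet n) : MvPolynomial (GenIdx n) ℤ := X (Sum.inr (Sum.inl K))
def zg {n : ℕ} : MvPolynomial (GenIdx n) ℤ := X (Sum.inr (Sum.inr ()))

/-- The values of the generators: x_v ↦ M_v, y_K ↦ Δ'_K, z ↦ X (= Q as a function). -/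
def gens' (n : ℕ) : GenIdx n → (Fin (2*n) → Rr n)
  | Sum.inl v => Mv v
  | Sum.inr (Sum.inl K) => Del' K.val
  | Sum.inr (Sum.inr _) => Qf

/-- The homomorphism ψ : P' → (V → R) determined by x_v ↦ M_v, y_K ↦ Δ'_K, z ↦ X. -/
noncomputable def psi (n : ℕ) : MvPolynomial (GenIdx n) ℤ →+* (Fin (2*n) → Rr n) :=
  (MvPolynomial.aeval (gens' n)).toRingHom

/-- The generating set of the ideal 𝔦': relations (i)–(iv). -/
def relSet' (n : ℕ) : Set (MvPolynomial (GenIdx n) ℤ) :=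
  -- (i) products over families with empty intersection
  {p | ∃ (F : Finset (Finset (Fin (2*n)))) (g : Finset (Fin (2*n)) → MvPolynomial (GenIdx n) ℤ),
        (∀ J ∈ F, (∃ v : Fin (2*n), J = {v}ᶜ ∧ g J = xg v) ∨
          (∃ h : J.Nonempty ∧ indep J, g J = yg ⟨J, h⟩)) ∧
        F.inf id = ∅ ∧ p = ∏ J ∈ F, g J} ∪
  -- (ii) x_v + x_{v̄} − 2z
  {p | ∃ v : Fin (2*n), p = xg v + xg (bar v) - 2 * zg} ∪
  -- (iii) ∏_{i∈I} x_i − (y_{V∖(I∪{a})} + y_{V∖(I∪{ā})}) for I with |I| = n−1 whose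
  -- complement contains exactly one pair {a, ā}
  {p | ∃ (I : Finset (Fin (2*n))) (a : Fin (2*n)), I.card = n - 1 ∧
        ({a, bar a} : Finset (Fin (2*n))) ⊆ Iᶜ ∧
        (∀ b : Fin (2*n), ({b, bar b} : Finset (Fin (2*n))) ⊆ Iᶜ → b = a ∨ b = bar a) ∧
        ∃ (h1 : ((I ∪ {a})ᶜ).Nonempty ∧ indep ((I ∪ {a})ᶜ))
          (h2 : ((I ∪ {bar a})ᶜ).Nonempty ∧ indep ((I ∪ {bar a})ᶜ)),
          p = ∏ i ∈ I, xg i - (yg ⟨(I ∪ {a})ᶜ, h1⟩ + yg ⟨(I ∪ {bar a})ᶜ, h2⟩)} ∪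
  -- (iv) y_K x_i − y_{K∖{i}} for {i} ⊊ K
  {p | ∃ (K : IndepSet n) (i : Fin (2*n)), ({i} : Finset (Fin (2*n))) ⊂ K.val ∧
        ∃ h : (K.val.erase i).Nonempty ∧ indep (K.val.erase i),
          p = yg K * xg i - yg ⟨K.val.erase i, h⟩}

section Vertices

variable {n : ℕ}

lemma bar_val (i : Fin (2*n)) : (bar i).val = 2*n - 1 - i.val := rfl

@[simp] lemma bar_bar (i : Fin (2*n)) : bar (bar i) = i := by
  ext; simp only [bar_val]; omega

lemma bar_ne (i : Fin (2*n)) : bar i ≠ i := by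
  intro h
  have := congrArg Fin.val h
  simp only [bar_val] at this
  omega

lemma bar_injective : Function.Injective (bar (n := n)) :=
  Function.LeftInverse.injective bar_bar

lemma eq_bar_comm {i j : Fin (2*n)} : i = bar j ↔ j = bar i := by
  constructor <;> (rintro rfl; simp)

lemma av_bar (i : Fin (2*n)) : av (bar i) = -av i := by
  have hi := i.isLt
  by_cases h : i.val < n
  · have h' : ¬ (bar i).val < n := by rw [bar_val]; omega
    simp only [av, h, h', dif_pos, dif_neg, not_false_eq_true]
    congr 2; ext; simp only [bar_val]; omega
  · have h' : (bar i).val < n := by rw [bar_val]; omega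
    rw [av, av, dif_pos h', dif_neg h, neg_neg]
    rfl

lemma ax_of_ne {i j : Fin (2*n)} (h : j ≠ bar i) : ax i j = av j - av i := by
  rw [ax, if_neg h]; ring

/-- The index of the variable occurring in `av v`. -/
def avIdx (v : Fin (2*n)) : Fin n :=
  if h : v.val < n then ⟨v.val, h⟩ else ⟨2*n - 1 - v.val, by omega⟩

lemma av_eq (v : Fin (2*n)) : av v = X (avIdx v) ∨ av v = -X (avIdx v) := by
  by_cases h : v.val < n <;> simp [av, avIdx, h]

lemma avIdx_eq_iff {u v : Fin (2*n)} : avIdx u = avIdx v ↔ u = v ∨ u = bar v := by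
  have hu := u.isLt
  have hv := v.isLt
  unfold avIdx
  split_ifs <;> simp only [Fin.ext_iff, bar_val] <;> omega

lemma av_injective : Function.Injective (av (n := n)) := by
  intro u v h
  have hn : (2 : ℤ) ≠ 0 := by norm_num
  by_cases hu : u.val < n <;> by_cases hv : v.val < n
  · simp only [av, hu, hv, dif_pos] at h
    simpa [Fin.ext_iff] using X_injective h
  · simp only [av, hu, hv, dif_pos, dif_neg, not_false_eq_true] at h
    have := congrArg (eval fun _ => (1 : ℤ)) h
    norm_num at this
  · simp only [av, hu, hv, dif_pos, dif_neg, not_false_eq_true] at h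
    have := congrArg (eval fun _ => (1 : ℤ)) h
    norm_num at this
  · simp only [av, hu, hv, dif_neg, not_false_eq_true, neg_inj] at h
    have := congrArg Fin.val (X_injective h)
    simp only at this
    ext; omega

/-- The substitution setting `av k` equal to `av j`. -/
lemma exists_substitution (j k : Fin (2*n)) :
    ∃ σ : Rr n →+* Rr n, σ (av k) = av j ∧
      (∀ u, u ≠ k → u ≠ bar k → σ (av u) = av u) ∧
      ∀ f, av j - av k ∣ f - σ f := by
  obtain ⟨s, hs, hk⟩ : ∃ s : Rr n, s * s = 1 ∧ av k = s * X (avIdx k) := by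
    rcases av_eq k with h | h
    · exact ⟨1, by simp, by simpa using h⟩
    · exact ⟨-1, by simp, by simpa using h⟩
  let g : Fin n → Rr n := fun i => if i = avIdx k then s * av j else X i
  have hs' : aeval (R := ℤ) g s = s := by
    rcases mul_self_eq_one_iff.mp hs with rfl | rfl <;> simp
  refine ⟨(aeval (R := ℤ) g).toRingHom, ?_, ?_, ?_⟩
  · change aeval (R := ℤ) g (av k) = _
    rw [hk, map_mul, hs', aeval_X]
    simp only [g, if_true]
    rw [← mul_assoc, hs, one_mul]
  · intro u hu hu'
    have hne : avIdx u ≠ avIdx k := fun h => (avIdx_eq_iff.mp h).elim hu hu'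
    change aeval (R := ℤ) g (av u) = _
    rcases av_eq u with h | h <;> rw [h] <;> simp [g, hne]
  · intro f
    change _ ∣ f - aeval (R := ℤ) g f
    induction f using MvPolynomial.induction_on with
    | C a => simp
    | add p q hp hq =>
      rw [map_add, add_sub_add_comm]; exact dvd_add hp hq
    | mul_X p i hp =>
      have hX : av j - av k ∣ X i - g i := by
        by_cases hi : i = avIdx k
        · refine ⟨-s, ?_⟩
          simp only [g, hi, if_true, hk]
          linear_combination (-X (avIdx k)) * hs
        · simp [g, hi]
      rw [map_mul, aeval_X]
      have e : p * X i - aeval (R := ℤ) g p * g i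
          = (p - aeval (R := ℤ) g p) * X i + aeval (R := ℤ) g p * (X i - g i) := by ring
      rw [e]
      exact dvd_add (hp.mul_right _) (hX.mul_left _)

lemma prime_av_sub_av {j k : Fin (2*n)} (hjk : j ≠ k) (hjk' : j ≠ bar k) :
    Prime (av j - av k) := by
  obtain ⟨σ, hσk, hσ, hdvd⟩ := exists_substitution j k
  have h0 : σ (av j - av k) = 0 := by rw [map_sub, hσk, hσ j hjk hjk', sub_self]
  have hz : ∀ f, σ f = 0 → av j - av k ∣ f := fun f hf => by simpa [hf] using hdvd f
  refine ⟨sub_ne_zero.mpr fun h => hjk (av_injective h), fun hu => ?_, fun a b hab => ?_⟩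
  · have := hu.map σ
    rw [h0] at this
    exact not_isUnit_zero this
  · obtain ⟨c, hc⟩ := hab
    have := congrArg σ hc
    rw [map_mul, map_mul, h0, zero_mul] at this
    exact (mul_eq_zero.mp this).imp (hz a) (hz b)

lemma isRelPrime_av_sub_av {i j k : Fin (2*n)} (hij : i ≠ j) (hi : i ≠ k) (hi' : i ≠ bar k)
    (hj : j ≠ k) (hj' : j ≠ bar k) : IsRelPrime (av i - av k) (av j - av k) := by
  rw [(prime_av_sub_av hi hi').irreducible.isRelPrime_iff_not_dvd]
  rintro ⟨c, hc⟩
  obtain ⟨σ, hσk, hσ, -⟩ := exists_substitution i k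
  have := congrArg σ hc
  rw [map_mul, map_sub, map_sub, hσk, hσ i hi hi', hσ j hj hj', sub_self, zero_mul] at this
  exact hij (av_injective (sub_eq_zero.mp this).symm)

lemma prod_av_sub_av_dvd {f : Fin (2*n) → Rr n} (hf : f ∈ HGQe n) {k : Fin (2*n)}
    {s : Finset (Fin (2*n))} (hk : k ∉ s) (hk' : bar k ∉ s) (hs : ∀ j ∈ s, f j = 0) :
    ∏ j ∈ s, (av j - av k) ∣ f k := by
  refine Finset.prod_dvd_of_isRelPrime ?_ ?_
  · intro i hi j hj hij
    exact isRelPrime_av_sub_av hij (fun h => hk (h ▸ hi)) (fun h => hk' (h ▸ hi))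
      (fun h => hk (h ▸ hj)) (fun h => hk' (h ▸ hj))
  · intro j hj
    have hjk' : j ≠ bar k := fun h => hk' (h ▸ hj)
    have := hf k j (fun h => hk (h ▸ hj)) hjk'
    rwa [ax_of_ne hjk', hs j hj, sub_zero] at this

end Vertices

section Classes

variable {n : ℕ}

lemma Mv_apply (v j : Fin (2*n)) : Mv v j = av v - av j := by
  unfold Mv
  split_ifs with h h'
  · rw [h, sub_self]
  · rw [h', av_bar]; ring
  · ring

lemma Del'_apply (K : Finset (Fin (2*n))) (j : Fin (2*n)) :
    Del' K j = if j ∈ K then ∏ k ∈ (insert (bar j) K)ᶜ, (av k - av j) else 0 := by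
  unfold Del'
  refine if_congr Iff.rfl ?_ rfl
  rw [union_singleton]
  refine prod_congr rfl fun k hk => ax_of_ne ?_
  rintro rfl
  simp at hk

lemma indep.bar_notMem {K : Finset (Fin (2*n))} (hK : indep K) {i : Fin (2*n)} (hi : i ∈ K) :
    bar i ∉ K := fun h => hK i (by simp [insert_subset_iff, hi, h])

lemma indep.mono {K L : Finset (Fin (2*n))} (hK : indep K) (h : L ⊆ K) : indep L :=
  fun i hi => hK i (hi.trans h)

lemma indep_of_bar_notMem {K : Finset (Fin (2*n))} (h : ∀ i ∈ K, bar i ∉ K) : indep K :=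
  fun i hi => h i (hi (by simp)) (hi (by simp))

lemma Qf_mem : Qf ∈ HGQe n := by
  intro i j _ h
  rw [ax_of_ne h]
  exact ⟨1, by simp only [Qf]; ring⟩

lemma Mv_mem (v : Fin (2*n)) : Mv v ∈ HGQe n := by
  intro i j _ h
  rw [ax_of_ne h, Mv_apply, Mv_apply]
  exact ⟨1, by ring⟩

lemma prod_sub_prod_dvd {R ι : Type*} [CommRing R] (s : Finset ι) (f : ι → R) (a b : R) :
    b - a ∣ ∏ k ∈ s, (f k - a) - ∏ k ∈ s, (f k - b) := by
  have h := Polynomial.sub_dvd_eval_sub b a (∏ k ∈ s, (Polynomial.C (f k) - Polynomial.X))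
  rw [Polynomial.eval_prod, Polynomial.eval_prod, dvd_sub_comm] at h
  simpa using h

lemma av_sub_dvd_Del' {K : Finset (Fin (2*n))} {i j : Fin (2*n)}
    (h : j ≠ bar i) (hi : i ∈ K) (hj : j ∉ K) : av j - av i ∣ Del' K i - Del' K j := by
  rw [Del'_apply, Del'_apply, if_pos hi, if_neg hj, sub_zero]
  exact dvd_prod_of_mem (fun k => av k - av i) (by simp [h, hj])

lemma Del'_mem {K : Finset (Fin (2*n))} (hK : indep K) : Del' K ∈ HGQe n := by
  intro i j hij h
  have h' : i ≠ bar j := fun e => h (eq_bar_comm.mp e)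
  rw [ax_of_ne h]
  by_cases hi : i ∈ K <;> by_cases hj : j ∈ K
  · rw [Del'_apply, Del'_apply, if_pos hi, if_pos hj]
    have key : ∀ a b : Fin (2*n), a ≠ b → b ∈ K → (insert (bar a) K)ᶜ
        = insert (bar b) (insert (bar a) (insert (bar b) K))ᶜ := by
      intro a b hab hb
      have h1 := hK.bar_notMem hb
      have h2 : bar b ≠ bar a := fun e => hab (bar_injective e).symm
      ext k
      simp only [mem_compl, mem_insert, not_or]
      by_cases hk : k = bar b
      · simp [hk, h1, h2]
      · simp [hk]
    rw [key i j hij hj, key j i hij.symm hi, insert_comm (bar j) (bar i) K,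
      prod_insert (by simp), prod_insert (by simp), av_bar, av_bar]
    have e : -av i - av j = -av j - av i := by ring
    rw [e, ← mul_sub]
    exact (prod_sub_prod_dvd _ _ _ _).mul_left _
  · exact av_sub_dvd_Del' h hi hj
  · rw [← neg_dvd, neg_sub, ← dvd_neg, neg_sub]
    exact av_sub_dvd_Del' h' hj hi
  · simp [Del'_apply, hi, hj]

end Classes

section Presentation

variable {n : ℕ}

/-- The `Rr n`-algebra structure of the presenting ring: `α_v` acts as `x_v - z`. -/
def scal (n : ℕ) : Rr n →+* MvPolynomial (GenIdx n) ℤ :=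
  (aeval fun i : Fin n => xg ⟨i.val, by omega⟩ - zg).toRingHom

open Classical in
/-- The indeterminate `y_K`, extended by zero to all subsets. -/
def yy (K : Finset (Fin (2*n))) : MvPolynomial (GenIdx n) ℤ :=
  if h : K.Nonempty ∧ indep K then yg ⟨K, h⟩ else 0

/-- The polynomials whose classes form an `Rr n`-basis of the quotient ring. -/
def basisPoly (k : Fin (2*n)) : MvPolynomial (GenIdx n) ℤ :=
  if k.val < n then ∏ j ∈ Iio k, xg j else yy (Ici k)

lemma yy_of_indep {K : Finset (Fin (2*n))} (hK : K.Nonempty) (h : indep K) :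
    yy K = yg ⟨K, hK, h⟩ := dif_pos ⟨hK, h⟩

lemma yy_empty : yy (∅ : Finset (Fin (2*n))) = 0 := dif_neg (by simp)

lemma psi_xg (v : Fin (2*n)) : psi n (xg v) = Mv v := aeval_X (gens' n) _

lemma psi_yg (K : IndepSet n) : psi n (yg K) = Del' K.val := aeval_X (gens' n) _

lemma psi_zg : psi n zg = Qf := aeval_X (gens' n) _

lemma psi_yy {K : Finset (Fin (2*n))} (hK : indep K) : psi n (yy K) = Del' K := by
  rcases K.eq_empty_or_nonempty with rfl | h
  · rw [yy_empty, map_zero]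
    ext1 j
    simp [Del']
  · rw [yy_of_indep h hK, psi_yg]

lemma scal_X (i : Fin n) : scal n (X i) = xg ⟨i.val, by omega⟩ - zg := aeval_X _ _

lemma psi_scal (r : Rr n) (j : Fin (2*n)) : psi n (scal n r) j = r := by
  have : ((Pi.evalRingHom (fun _ => Rr n) j).comp (psi n)).comp (scal n) = RingHom.id _ := by
    refine MvPolynomial.ringHom_ext (fun a => by simp) fun i => ?_
    have hi : i.val < n := i.isLt
    change psi n (scal n (X i)) j = X i
    rw [scal_X, map_sub, psi_xg, psi_zg, Pi.sub_apply, Mv_apply, Qf]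
    simp [av, hi]
  exact RingHom.congr_fun this r

lemma psi_mem (p : MvPolynomial (GenIdx n) ℤ) : psi n p ∈ HGQe n := by
  induction p using MvPolynomial.induction_on with
  | C a =>
    intro i j _ _
    simp [psi]
  | add p q hp hq => rw [map_add]; exact add_mem hp hq
  | mul_X p v hp =>
    rw [map_mul]
    refine mul_mem hp ?_
    rcases v with v | K | u
    · exact (psi_xg v).symm ▸ Mv_mem v
    · exact (psi_yg K).symm ▸ Del'_mem K.2.2
    · exact (psi_zg (n := n)).symm ▸ Qf_mem

lemma psi_prod_eq_zero {F : Finset (Finset (Fin (2*n)))}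
    {g : Finset (Fin (2*n)) → MvPolynomial (GenIdx n) ℤ}
    (hg : ∀ J ∈ F, (∃ v : Fin (2*n), J = {v}ᶜ ∧ g J = xg v) ∨
      (∃ h : J.Nonempty ∧ indep J, g J = yg ⟨J, h⟩))
    (hF : F.inf id = ∅) : psi n (∏ J ∈ F, g J) = 0 := by
  ext1 j
  have hj : j ∉ F.inf id := by simp [hF]
  rw [Finset.mem_inf] at hj
  push Not at hj
  obtain ⟨J, hJ, hjJ⟩ := hj
  rw [map_prod, Finset.prod_apply, Pi.zero_apply]
  refine prod_eq_zero hJ ?_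
  rcases hg J hJ with ⟨v, rfl, h⟩ | ⟨h, h'⟩
  · have : j = v := by simpa using hjJ
    rw [h, psi_xg, Mv_apply, this, sub_self]
  · rw [h', psi_yg, Del'_apply, if_neg (by simpa using hjJ)]

/-- If `I` meets every pair except `{a, bar a}`, the product of the `Mv i` over `I` splits. -/
lemma prod_Mv_eq_add {I : Finset (Fin (2*n))} {a : Fin (2*n)} (ha : a ∉ I) (ha' : bar a ∉ I)
    (hI : ∀ b : Fin (2*n), ({b, bar b} : Finset (Fin (2*n))) ⊆ Iᶜ → b = a ∨ b = bar a) :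
    ∏ i ∈ I, Mv i = Del' (I ∪ {a})ᶜ + Del' (I ∪ {bar a})ᶜ := by
  ext1 j
  have hab := bar_ne a
  rw [Finset.prod_apply, Pi.add_apply, Del'_apply, Del'_apply]
  simp only [Mv_apply]
  by_cases hj : j ∈ I
  · rw [prod_eq_zero hj (sub_self _)]
    simp [hj]
  by_cases hja : j = a
  · subst hja
    simp [hj, hab.symm, erase_eq_of_notMem ha']
  by_cases hja' : j = bar a
  · subst hja'
    simp [hj, hab, erase_eq_of_notMem ha]
  have hbj : bar j ∈ I := by
    by_contra hbj
    rcases hI j (by simp [insert_subset_iff, hj, hbj]) with h | h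
    · exact hja h
    · exact hja' h
  have e : ∀ b, b ∉ I → b ≠ bar j →
      (insert (bar j) (I ∪ {b})ᶜ)ᶜ = insert b (I.erase (bar j)) := by
    intro b hb hbj'
    ext k
    by_cases hk : k = b
    · simp [hk, hbj']
    · simp [hk]
  rw [if_pos (by simp [hj, hja]), if_pos (by simp [hj, hja']),
    e a ha (fun h => ha (h ▸ hbj)), e (bar a) ha' (fun h => ha' (h ▸ hbj)),
    prod_insert (by simp [ha]), prod_insert (by simp [ha']), ← mul_prod_erase I _ hbj,
    av_bar, av_bar]
  ring

lemma Del'_mul_Mv {K : Finset (Fin (2*n))} (hK : indep K) {i : Fin (2*n)} (hi : i ∈ K) :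
    Del' K * Mv i = Del' (K.erase i) := by
  ext1 j
  rw [Pi.mul_apply, Mv_apply, Del'_apply, Del'_apply]
  by_cases hji : j = i
  · simp [hji]
  by_cases hj : j ∈ K
  · have e : (insert (bar j) (K.erase i))ᶜ = insert i (insert (bar j) K)ᶜ := by
      have : i ≠ bar j := fun h => hK.bar_notMem hj (h ▸ hi)
      ext k
      by_cases hk : k = i
      · simp [hk, this]
      · simp [hk]
    rw [if_pos hj, if_pos (by simp [hji, hj]), e, prod_insert (by simp [hi]), mul_comm]
  · simp [hj]

lemma span_relSet'_le_ker : Ideal.span (relSet' n) ≤ RingHom.ker (psi n) := by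
  rw [Ideal.span_le]
  rintro p (((⟨F, g, hg, hF, rfl⟩ | ⟨v, rfl⟩) | ⟨I, a, -, haI, hI, h1, h2, rfl⟩) |
    ⟨K, i, hi, h, rfl⟩)
  · exact psi_prod_eq_zero hg hF
  · change psi n _ = 0
    ext1 j
    simp only [map_sub, map_add, map_mul, map_ofNat, psi_xg, psi_zg, Pi.sub_apply, Pi.add_apply,
      Pi.mul_apply, Mv_apply, Qf, av_bar, Pi.ofNat_apply]
    ring
  · change psi n _ = 0
    have ha : a ∉ I := by simpa using haI (mem_insert_self _ _)
    have ha' : bar a ∉ I := by simpa using haI (mem_insert_of_mem (mem_singleton_self _))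
    rw [map_sub, map_add, map_prod, psi_yg, psi_yg, sub_eq_zero]
    simp only [psi_xg]
    exact prod_Mv_eq_add ha ha' hI
  · change psi n _ = 0
    rw [map_sub, map_mul, psi_yg, psi_xg, psi_yg, sub_eq_zero]
    exact Del'_mul_Mv K.2.2 (singleton_subset_iff.mp hi.subset)

lemma relation_xg (v : Fin (2*n)) :
    xg v - (zg + scal n (av v)) ∈ Ideal.span (relSet' n) := by
  by_cases h : v.val < n
  · rw [av, dif_pos h, scal_X]
    simp
  · have hv : (⟨2*n - 1 - v.val, by omega⟩ : Fin (2*n)) = bar v := rfl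
    rw [av, dif_neg h, map_neg, scal_X, hv]
    have e : xg v - (zg + -(xg (bar v) - zg)) = xg v + xg (bar v) - 2 * zg := by ring
    rw [e]
    exact Ideal.subset_span (Or.inl (Or.inl (Or.inr ⟨v, rfl⟩)))

lemma yy_mul_yy_mem {K L : Finset (Fin (2*n))} (hK : indep K) (hL : indep L)
    (h : Disjoint K L) : yy K * yy L ∈ Ideal.span (relSet' n) := by
  rcases K.eq_empty_or_nonempty with rfl | hK'
  · simp [yy_empty]
  rcases L.eq_empty_or_nonempty with rfl | hL'
  · simp [yy_empty]
  have hKL : K ≠ L := fun e => hK'.ne_empty (disjoint_self.mp (e ▸ h))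
  refine Ideal.subset_span (Or.inl (Or.inl (Or.inl ⟨{K, L}, yy, ?_, ?_, ?_⟩)))
  · intro J hJ
    right
    rcases mem_insert.mp hJ with rfl | hJ
    · exact ⟨⟨hK', hK⟩, yy_of_indep hK' hK⟩
    · obtain rfl := mem_singleton.mp hJ
      exact ⟨⟨hL', hL⟩, yy_of_indep hL' hL⟩
  · simpa [inf_insert] using disjoint_iff_inter_eq_empty.mp h
  · rw [prod_pair hKL]

lemma yy_singleton_mul_xg_mem (i : Fin (2*n)) :
    yy {i} * xg i ∈ Ideal.span (relSet' n) := by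
  have hi : indep {i} := indep_of_bar_notMem fun j hj => by
    obtain rfl := mem_singleton.mp hj
    simpa using bar_ne j
  have hne : ({i} : Finset (Fin (2*n))) ≠ {i}ᶜ := fun h => by
    have : i ∈ ({i}ᶜ : Finset (Fin (2*n))) := h ▸ mem_singleton_self i
    simp at this
  refine Ideal.subset_span (Or.inl (Or.inl (Or.inl
    ⟨{{i}, {i}ᶜ}, fun J => if J = {i} then yy {i} else xg i, ?_, ?_, ?_⟩)))
  · intro J hJ
    rcases mem_insert.mp hJ with rfl | hJ
    · exact Or.inr ⟨⟨singleton_nonempty i, hi⟩,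
        (if_pos rfl).trans (yy_of_indep (singleton_nonempty i) hi)⟩
    · obtain rfl := mem_singleton.mp hJ
      exact Or.inl ⟨i, rfl, if_neg hne.symm⟩
  · simp [inf_insert]
  · rw [prod_pair hne, if_pos rfl, if_neg hne.symm]

lemma yy_mul_xg_sub_mem {K : Finset (Fin (2*n))} (hK : indep K) {i : Fin (2*n)}
    (hi : i ∈ K) : yy K * xg i - yy (K.erase i) ∈ Ideal.span (relSet' n) := by
  rcases (singleton_subset_iff.mpr hi).eq_or_ssubset with rfl | h
  · rw [erase_singleton, yy_empty, sub_zero]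
    exact yy_singleton_mul_xg_mem i
  · have hne : (K.erase i).Nonempty := by
      obtain ⟨j, hj, hji⟩ := exists_of_ssubset h
      exact ⟨j, mem_erase.mpr ⟨by simpa using hji, hj⟩⟩
    have hind : indep (K.erase i) := hK.mono (erase_subset i K)
    rw [yy_of_indep ⟨i, hi⟩ hK, yy_of_indep hne hind]
    exact Ideal.subset_span (Or.inr ⟨⟨K, ⟨i, hi⟩, hK⟩, i, h, ⟨hne, hind⟩, rfl⟩)

/-- `K` contains exactly one element of every pair `{i, bar i}`. -/
def IsTransversal (K : Finset (Fin (2*n))) : Prop := ∀ i, i ∈ K ↔ bar i ∉ K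

lemma IsTransversal.indep {K : Finset (Fin (2*n))} (hK : IsTransversal K) : indep K :=
  indep_of_bar_notMem fun i => (hK i).mp

lemma IsTransversal.card {K : Finset (Fin (2*n))} (hK : IsTransversal K) : K.card = n := by
  have h : K.image bar = Kᶜ := by
    ext i
    rw [mem_image, mem_compl]
    constructor
    · rintro ⟨j, hj, rfl⟩
      exact (hK j).mp hj
    · intro hi
      exact ⟨bar i, (hK _).mpr (by rwa [bar_bar]), bar_bar i⟩
  have := congrArg Finset.card h
  rw [card_image_of_injective _ bar_injective, card_compl, Fintype.card_fin] at this
  have := card_le_univ K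
  rw [Fintype.card_fin] at this
  omega

lemma IsTransversal.eq_of_subset {K L : Finset (Fin (2*n))} (hK : IsTransversal K)
    (hL : IsTransversal L) (h : K ⊆ L) : K = L :=
  Finset.eq_of_subset_of_card_le h (by rw [hK.card, hL.card])

lemma IsTransversal.flip {K : Finset (Fin (2*n))} (hK : IsTransversal K) {c : Fin (2*n)}
    (hc : c ∈ K) : IsTransversal (insert (bar c) (K.erase c)) := by
  intro i
  have h1 := bar_ne c
  have h2 := hK i
  have h3 : bar i = bar c ↔ i = c := bar_injective.eq_iff
  have h4 : bar i = c ↔ i = bar c := by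
    rw [eq_comm, eq_bar_comm]
  simp only [mem_insert, mem_erase, h3, h4, ne_eq]
  by_cases hi : i = c
  · subst hi; simp [h1.symm]
  by_cases hi' : i = bar c
  · subst hi'; simp [h1]
  simp [hi, hi', h2]

lemma isTransversal_Iio : IsTransversal ({i | i.val < n} : Finset (Fin (2*n))) := by
  intro i
  have := i.isLt
  simp only [mem_filter_univ, bar_val]
  omega

lemma isTransversal_Ici : IsTransversal ({i | n ≤ i.val} : Finset (Fin (2*n))) := by
  intro i
  have := i.isLt
  simp only [mem_filter_univ, bar_val]
  omega

lemma indep.exists_isTransversal {K : Finset (Fin (2*n))} (hK : indep K) :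
    ∃ L, K ⊆ L ∧ IsTransversal L := by
  refine ⟨K ∪ univ.filter fun i => i.val < n ∧ bar i ∉ K, subset_union_left, fun i => ?_⟩
  have := i.isLt
  have h := hK.bar_notMem (i := i)
  simp only [mem_union, mem_filter_univ, bar_bar]
  have hlt : (bar i).val < n ↔ ¬ i.val < n := by rw [bar_val]; omega
  rw [hlt]
  tauto

lemma yy_add_yy_flip_sub_mem (hn : 2 ≤ n) {K : Finset (Fin (2*n))} (hK : IsTransversal K)
    {c : Fin (2*n)} (hc : c ∈ K) :
    ∏ i ∈ (insert (bar c) K)ᶜ, xg i - (yy K + yy (insert (bar c) (K.erase c)))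
      ∈ Ideal.span (relSet' n) := by
  have hbc : bar c ∉ K := (hK c).mp hc
  have hL := hK.flip hc
  have e1 : ((insert (bar c) K)ᶜ ∪ {bar c})ᶜ = K := by
    ext k
    by_cases hk : k = bar c <;> simp [hk, hbc]
  have e2 : ((insert (bar c) K)ᶜ ∪ {bar (bar c)})ᶜ = insert (bar c) (K.erase c) := by
    ext k
    rw [bar_bar]
    by_cases hk : k = c
    · simp [hk, (bar_ne c).symm]
    · simp [hk]
  have hne : (insert (bar c) (K.erase c)).Nonempty := insert_nonempty _ _
  have key : ∀ {A B : Finset (Fin (2*n))} (hA : A.Nonempty ∧ indep A) (h : A = B),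
      yg ⟨A, hA⟩ = yy B := by
    rintro A _ hA rfl
    exact (yy_of_indep hA.1 hA.2).symm
  have h1 : (((insert (bar c) K)ᶜ ∪ {bar c})ᶜ).Nonempty ∧
      indep ((insert (bar c) K)ᶜ ∪ {bar c})ᶜ := by
    rw [e1]; exact ⟨⟨c, hc⟩, hK.indep⟩
  have h2 : (((insert (bar c) K)ᶜ ∪ {bar (bar c)})ᶜ).Nonempty ∧
      indep ((insert (bar c) K)ᶜ ∪ {bar (bar c)})ᶜ := by
    rw [e2]; exact ⟨hne, hL.indep⟩
  refine Ideal.subset_span (Or.inl (Or.inr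
    ⟨(insert (bar c) K)ᶜ, bar c, ?_, ?_, ?_, h1, h2, ?_⟩))
  · rw [card_compl, card_insert_of_notMem hbc, hK.card, Fintype.card_fin]
    omega
  · simp [insert_subset_iff, hc]
  · intro b hb
    simp only [compl_compl, insert_subset_iff, mem_insert, singleton_subset_iff] at hb
    obtain ⟨rfl | hb, hb' | hb'⟩ := hb
    · exact Or.inl rfl
    · exact Or.inl rfl
    · exact Or.inr (eq_bar_comm.mp hb'.symm)
    · exact absurd hb' ((hK b).mp hb)
  · rw [key h1 e1, key h2 e2]

end Presentation

section Spanning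

variable {n : ℕ}

/-- The preimage of the `Rr n`-span of the classes of the `basisPoly k`. -/
def spanned (n : ℕ) : AddSubgroup (MvPolynomial (GenIdx n) ℤ) where
  carrier := {p | ∃ c : Fin (2*n) → Rr n,
    p - ∑ k, scal n (c k) * basisPoly k ∈ Ideal.span (relSet' n)}
  zero_mem' := ⟨0, by simp⟩
  add_mem' := by
    rintro p q ⟨c, hc⟩ ⟨d, hd⟩
    refine ⟨c + d, ?_⟩
    convert add_mem hc hd using 1
    simp only [Pi.add_apply, map_add, add_mul, sum_add_distrib]
    ring
  neg_mem' := by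
    rintro p ⟨c, hc⟩
    refine ⟨-c, ?_⟩
    convert neg_mem hc using 1
    simp only [Pi.neg_apply, map_neg, neg_mul, sum_neg_distrib]
    ring

lemma mem_spanned {p : MvPolynomial (GenIdx n) ℤ} : p ∈ spanned n ↔
    ∃ c : Fin (2*n) → Rr n, p - ∑ k, scal n (c k) * basisPoly k ∈ Ideal.span (relSet' n) :=
  Iff.rfl

lemma mem_spanned_of_mem_span {p : MvPolynomial (GenIdx n) ℤ}
    (h : p ∈ Ideal.span (relSet' n)) : p ∈ spanned n := ⟨0, by simpa using h⟩

lemma mem_spanned_of_sub_mem {p q : MvPolynomial (GenIdx n) ℤ} (hq : q ∈ spanned n)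
    (h : p - q ∈ Ideal.span (relSet' n)) : p ∈ spanned n := by
  have := add_mem (mem_spanned_of_mem_span h) hq
  rwa [sub_add_cancel] at this

lemma basisPoly_mem (k : Fin (2*n)) : basisPoly k ∈ spanned n := by
  refine ⟨Pi.single k 1, ?_⟩
  rw [sum_eq_single k (fun j _ hj => by simp [hj]) (by simp)]
  simp

lemma scal_mul_mem {p : MvPolynomial (GenIdx n) ℤ} (hp : p ∈ spanned n) (r : Rr n) :
    scal n r * p ∈ spanned n := by
  obtain ⟨c, hc⟩ := hp
  refine ⟨fun k => r * c k, ?_⟩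
  convert Ideal.mul_mem_left _ (scal n r) hc using 1
  simp only [map_mul, mul_sub, mul_sum, mul_assoc]

/-- Closure under multiplication by `q` can be checked on the `basisPoly k`. -/
lemma mul_mem_spanned {q : MvPolynomial (GenIdx n) ℤ}
    (hq : ∀ k : Fin (2*n), q * basisPoly k ∈ spanned n) {p : MvPolynomial (GenIdx n) ℤ}
    (hp : p ∈ spanned n) : q * p ∈ spanned n := by
  obtain ⟨c, hc⟩ := hp
  refine mem_spanned_of_sub_mem (q := ∑ k, scal n (c k) * (q * basisPoly k))
    (sum_mem fun k _ => scal_mul_mem (hq k) _) ?_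
  convert Ideal.mul_mem_left _ q hc using 1
  rw [mul_sub, mul_sum]
  congr 1
  exact sum_congr rfl fun k _ => by ring

lemma zg_mul_mem_of_xg_mul_mem {p : MvPolynomial (GenIdx n) ℤ} (hp : p ∈ spanned n)
    {v : Fin (2*n)} (h : xg v * p ∈ spanned n) : zg * p ∈ spanned n := by
  refine mem_spanned_of_sub_mem (sub_mem h (scal_mul_mem hp (av v))) ?_
  convert Ideal.mul_mem_left _ (-p) (relation_xg v) using 1
  ring

lemma xg_mul_mem_of_zg_mul_mem {p : MvPolynomial (GenIdx n) ℤ} (hp : p ∈ spanned n)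
    (v : Fin (2*n)) (h : zg * p ∈ spanned n) : xg v * p ∈ spanned n := by
  refine mem_spanned_of_sub_mem (add_mem h (scal_mul_mem hp (av v))) ?_
  convert Ideal.mul_mem_left _ p (relation_xg v) using 1
  ring

lemma basisPoly_of_lt {k : Fin (2*n)} (h : k.val < n) : basisPoly k = ∏ j ∈ Iio k, xg j :=
  if_pos h

lemma basisPoly_of_le {k : Fin (2*n)} (h : n ≤ k.val) : basisPoly k = yy (Ici k) :=
  if_neg h.not_gt

lemma indep_Ici {k : Fin (2*n)} (h : n ≤ k.val) : indep (Ici k) :=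
  isTransversal_Ici.indep.mono fun i hi => by
    have : k ≤ i := by simpa using hi
    simpa using h.trans this

lemma xg_mul_basisPoly_of_lt {k : Fin (2*n)} (h : k.val < n) :
    xg k * basisPoly k = ∏ j ∈ Iic k, xg j := by
  rw [basisPoly_of_lt h, ← Iio_insert k, prod_insert (by simp)]

/-- `x_k y_{≥ k}` is a basis class, or zero. -/
lemma xg_mul_basisPoly_of_le {k : Fin (2*n)} (h : n ≤ k.val) :
    xg k * basisPoly k ∈ spanned n := by
  rw [basisPoly_of_le h, mul_comm]
  refine mem_spanned_of_sub_mem ?_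
    (yy_mul_xg_sub_mem (indep_Ici h) (mem_Ici.mpr le_rfl))
  by_cases hk : k.val + 1 < 2*n
  · have e : (Ici k).erase k = Ici ⟨k.val + 1, hk⟩ := by
      ext i
      simp only [mem_erase, mem_Ici, ne_eq, Fin.ext_iff, Fin.le_def]
      omega
    rw [e, ← basisPoly_of_le (k := ⟨k.val + 1, hk⟩) (by simp only; omega)]
    exact basisPoly_mem _
  · have e : (Ici k).erase k = ∅ := by
      ext i
      simp only [mem_erase, mem_Ici, ne_eq, Fin.ext_iff, Fin.le_def, notMem_empty, iff_false]
      omega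
    rw [e, yy_empty]
    exact zero_mem _

lemma xg_mul_basisPoly_mem (hn : 2 ≤ n) (k : Fin (2*n)) : xg k * basisPoly k ∈ spanned n := by
  by_cases hk : n ≤ k.val
  · exact xg_mul_basisPoly_of_le hk
  by_cases hk' : k.val + 1 < n
  · have e : Iic k = Iio (⟨k.val + 1, by omega⟩ : Fin (2*n)) := by
      ext i
      simp only [mem_Iic, mem_Iio, Fin.le_def, Fin.lt_def]
      omega
    rw [xg_mul_basisPoly_of_lt (by omega), e, ← basisPoly_of_lt (by simpa using hk')]
    exact basisPoly_mem _
  have hkn : k.val + 1 = n := by omega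
  have hbk : (bar k).val = n := by rw [bar_val]; omega
  set l := bar k with hl
  have hT : IsTransversal (Ici l) := by
    convert isTransversal_Ici (n := n) using 1
    ext i
    simp [Fin.le_def, hbk]
  have hlT : l ∈ Ici l := by simp
  have hbl : bar l = k := by rw [hl, bar_bar]
  have hflip := yy_add_yy_flip_sub_mem hn hT hlT
  rw [hbl] at hflip
  have hc : (insert k (Ici l))ᶜ = Iio k := by
    ext i
    simp only [mem_compl, mem_insert, mem_Ici, mem_Iio, Fin.le_def, Fin.lt_def, Fin.ext_iff, hbk]
    omega
  rw [hc] at hflip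
  have hxy : xg k * yy (Ici l) ∈ spanned n := by
    rw [← basisPoly_of_le hbk.ge]
    exact xg_mul_mem_of_zg_mul_mem (basisPoly_mem l) k (zg_mul_mem_of_xg_mul_mem (basisPoly_mem l)
      (xg_mul_basisPoly_of_le hbk.ge))
  have hk2 : k ∉ Ici l := by simp [Fin.lt_def, hbk]; omega
  have herase : (insert k ((Ici l).erase l)).erase k = (Ici l).erase l :=
    erase_insert (fun h => hk2 (mem_of_mem_erase h))
  have hyy := yy_mul_xg_sub_mem (hbl ▸ (hT.flip hlT).indep)
    (mem_insert_self k ((Ici l).erase l))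
  have hyl := yy_mul_xg_sub_mem hT.indep hlT
  rw [herase] at hyy
  have hye : xg l * yy (Ici l) ∈ spanned n := by
    rw [← basisPoly_of_le hbk.ge]
    exact xg_mul_basisPoly_of_le hbk.ge
  rw [basisPoly_of_lt (by omega)]
  refine mem_spanned_of_sub_mem (add_mem hxy hye) ?_
  convert add_mem (sub_mem (Ideal.mul_mem_left _ (xg k) hflip) hyl) hyy using 1
  ring

lemma zg_mul_mem (hn : 2 ≤ n) {p : MvPolynomial (GenIdx n) ℤ} (hp : p ∈ spanned n) :
    zg * p ∈ spanned n :=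
  mul_mem_spanned (fun k => zg_mul_mem_of_xg_mul_mem (basisPoly_mem k)
    (xg_mul_basisPoly_mem hn k)) hp

lemma xg_mul_mem (hn : 2 ≤ n) {p : MvPolynomial (GenIdx n) ℤ} (hp : p ∈ spanned n)
    (v : Fin (2*n)) : xg v * p ∈ spanned n :=
  xg_mul_mem_of_zg_mul_mem hp v (zg_mul_mem hn hp)

lemma prod_xg_mul_mem (hn : 2 ≤ n) {p : MvPolynomial (GenIdx n) ℤ} (hp : p ∈ spanned n)
    (s : Finset (Fin (2*n))) : (∏ i ∈ s, xg i) * p ∈ spanned n := by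
  induction s using Finset.induction_on with
  | empty => simpa using hp
  | insert i s hi ih =>
    rw [prod_insert hi, mul_assoc]
    exact xg_mul_mem hn ih i

lemma one_mem_spanned (hn : 2 ≤ n) : (1 : MvPolynomial (GenIdx n) ℤ) ∈ spanned n := by
  have e : Iio (⟨0, by omega⟩ : Fin (2*n)) = ∅ := by
    ext i
    simp [Fin.lt_def]
  have := basisPoly_mem (⟨0, by omega⟩ : Fin (2*n))
  rwa [basisPoly_of_lt (by simp only; omega), e, prod_empty] at this

lemma yy_mul_mem_of_isTransversal (hn : 2 ≤ n) {q : MvPolynomial (GenIdx n) ℤ}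
    (hq : q ∈ spanned n) {K₀ : Finset (Fin (2*n))} (hK₀ : IsTransversal K₀)
    (h₀ : yy K₀ * q ∈ spanned n) {K : Finset (Fin (2*n))} (hK : IsTransversal K) :
    yy K * q ∈ spanned n := by
  induction hm : (K \ K₀).card generalizing K with
  | zero =>
    have : K ⊆ K₀ := sdiff_eq_empty_iff_subset.mp (card_eq_zero.mp hm)
    rwa [hK.eq_of_subset hK₀ this]
  | succ m ih =>
    obtain ⟨c, hc⟩ : (K \ K₀).Nonempty := card_pos.mp (by omega)
    obtain ⟨hcK, hcK₀⟩ := mem_sdiff.mp hc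
    have hbc : bar c ∈ K₀ := by
      by_contra h
      exact hcK₀ ((hK₀ c).mpr h)
    have e : insert (bar c) (K.erase c) \ K₀ = (K \ K₀).erase c := by
      rw [insert_sdiff_of_mem _ hbc, erase_sdiff_comm]
    have hflip := ih (hK.flip hcK) (by rw [e, card_erase_of_mem hc, hm]; rfl)
    refine mem_spanned_of_sub_mem
      (sub_mem (prod_xg_mul_mem hn hq (insert (bar c) K)ᶜ) hflip) ?_
    convert Ideal.mul_mem_left _ (-q) (yy_add_yy_flip_sub_mem hn hK hcK) using 1
    ring

lemma yy_mul_mem_of_indep (hn : 2 ≤ n) {q : MvPolynomial (GenIdx n) ℤ}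
    (hq : q ∈ spanned n) {K₀ : Finset (Fin (2*n))} (hK₀ : IsTransversal K₀)
    (h₀ : yy K₀ * q ∈ spanned n) {K : Finset (Fin (2*n))} (hK : indep K) :
    yy K * q ∈ spanned n := by
  obtain ⟨L, hKL, hL⟩ := hK.exists_isTransversal
  have key : ∀ D : Finset (Fin (2*n)), D ⊆ L → yy (L \ D) * q ∈ spanned n := by
    intro D
    induction D using Finset.induction_on with
    | empty => intro _; rw [sdiff_empty]; exact yy_mul_mem_of_isTransversal hn hq hK₀ h₀ hL
    | insert i D hi ih =>
      intro hD
      obtain ⟨hiL, hDL⟩ := insert_subset_iff.mp hD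
      have h := yy_mul_xg_sub_mem (hL.indep.mono sdiff_subset) (mem_sdiff.mpr ⟨hiL, hi⟩)
      rw [sdiff_insert]
      refine mem_spanned_of_sub_mem (xg_mul_mem hn (ih hDL) i) ?_
      convert Ideal.mul_mem_left _ (-q) h using 1
      ring
  have := key (L \ K) sdiff_subset
  rwa [Finset.sdiff_sdiff_eq_self hKL] at this

lemma yy_mem_spanned (hn : 2 ≤ n) {K : Finset (Fin (2*n))} (hK : indep K) :
    yy K ∈ spanned n := by
  rw [← mul_one (yy K)]
  refine yy_mul_mem_of_indep hn (one_mem_spanned hn) isTransversal_Ici ?_ hK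
  have e : ({i | n ≤ i.val} : Finset (Fin (2*n))) = Ici ⟨n, by omega⟩ := by
    ext i
    simp [Fin.le_def]
  rw [mul_one, e, ← basisPoly_of_le le_rfl]
  exact basisPoly_mem _

lemma yy_mul_mem (hn : 2 ≤ n) {K : Finset (Fin (2*n))} (hK : indep K)
    {p : MvPolynomial (GenIdx n) ℤ} (hp : p ∈ spanned n) : yy K * p ∈ spanned n := by
  refine mul_mem_spanned (fun k => ?_) hp
  by_cases hk : k.val < n
  · rw [basisPoly_of_lt hk, mul_comm]
    exact prod_xg_mul_mem hn (yy_mem_spanned hn hK) _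
  · push Not at hk
    refine yy_mul_mem_of_indep hn (basisPoly_mem k) isTransversal_Iio ?_ hK
    rw [basisPoly_of_le hk]
    refine mem_spanned_of_mem_span
      (yy_mul_yy_mem isTransversal_Iio.indep (indep_Ici hk) ?_)
    rw [Finset.disjoint_left]
    intro i hi hi'
    simp only [mem_filter_univ, mem_Ici, Fin.le_def] at hi hi'
    omega

/-- The classes of the `basisPoly k` generate the quotient ring as an `Rr n`-module. -/
lemma mem_spanned_all (hn : 2 ≤ n) (p : MvPolynomial (GenIdx n) ℤ) : p ∈ spanned n := by
  induction p using MvPolynomial.induction_on with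
  | C a =>
    have := zsmul_mem (one_mem_spanned hn) a
    simpa using this
  | add p q hp hq => exact add_mem hp hq
  | mul_X p v hp =>
    rw [mul_comm]
    rcases v with v | K | u
    · exact xg_mul_mem hn hp v
    · have := yy_mul_mem hn K.2.2 hp
      rwa [yy_of_indep K.2.1 K.2.2] at this
    · exact zg_mul_mem hn hp

end Spanning

section Triangularity

variable {n : ℕ}

lemma psi_basisPoly_of_lt {j k : Fin (2*n)} (h : j < k) : psi n (basisPoly k) j = 0 := by
  by_cases hk : k.val < n
  · rw [basisPoly_of_lt hk, map_prod, Finset.prod_apply]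
    exact prod_eq_zero (mem_Iio.mpr h) (by rw [psi_xg, Mv_apply, sub_self])
  · push Not at hk
    rw [basisPoly_of_le hk, psi_yy (indep_Ici hk), Del'_apply, if_neg (by simpa using h)]

lemma psi_basisPoly_self (k : Fin (2*n)) :
    psi n (basisPoly k) k = ∏ j ∈ (Iio k).erase (bar k), (av j - av k) := by
  by_cases hk : k.val < n
  · have : bar k ∉ Iio k := by
      simp only [mem_Iio, Fin.lt_def, bar_val]; omega
    rw [basisPoly_of_lt hk, map_prod, Finset.prod_apply, erase_eq_of_notMem this]
    exact prod_congr rfl fun j _ => by rw [psi_xg, Mv_apply]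
  · push Not at hk
    rw [basisPoly_of_le hk, psi_yy (indep_Ici hk), Del'_apply, if_pos (by simp)]
    refine prod_congr ?_ fun _ _ => rfl
    ext j
    simp

lemma psi_basisPoly_self_ne_zero (k : Fin (2*n)) : psi n (basisPoly k) k ≠ 0 := by
  rw [psi_basisPoly_self, prod_ne_zero_iff]
  intro j hj h
  have : j = k := av_injective (sub_eq_zero.mp h)
  simp [this] at hj

lemma eq_zero_of_psi_sum_eq_zero {c : Fin (2*n) → Rr n}
    (h : psi n (∑ k, scal n (c k) * basisPoly k) = 0) : c = 0 := by
  ext1 k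
  induction k using WellFoundedLT.induction with
  | ind k ih =>
    have hk := congrFun h k
    rw [map_sum, Finset.sum_apply, sum_eq_single k] at hk
    · rw [map_mul, Pi.mul_apply, psi_scal] at hk
      exact (mul_eq_zero.mp hk).resolve_right (psi_basisPoly_self_ne_zero k)
    · intro i _ hik
      rw [map_mul, Pi.mul_apply, psi_scal]
      rcases lt_or_gt_of_ne hik with hi | hi
      · rw [ih i hi, Pi.zero_apply, zero_mul]
      · rw [psi_basisPoly_of_lt hi, mul_zero]
    · simp

lemma exists_psi_eq_of_vanishing {m : ℕ} {f : Fin (2*n) → Rr n}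
    (hf : f ∈ HGQe n) (h : ∀ j : Fin (2*n), j.val < m → f j = 0) : ∃ p, psi n p = f := by
  induction hd : 2*n - m generalizing m f with
  | zero =>
    exact ⟨0, by ext1 j; rw [map_zero, Pi.zero_apply, h j (by omega)]⟩
  | succ d ih =>
    have hm : m < 2*n := by omega
    let k : Fin (2*n) := ⟨m, hm⟩
    obtain ⟨q, hq⟩ : psi n (basisPoly k) k ∣ f k := by
      rw [psi_basisPoly_self]
      exact prod_av_sub_av_dvd hf (by simp) (by simp)
        fun j hj => h j (Fin.lt_def.mp (mem_Iio.mp (mem_of_mem_erase hj)))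
    obtain ⟨p, hp⟩ := ih (m := m + 1) (f := f - psi n (scal n q * basisPoly k))
      (sub_mem hf (psi_mem _))
      (fun j hj => by
        rw [map_mul, Pi.sub_apply, Pi.mul_apply, psi_scal]
        rcases Nat.lt_succ_iff_lt_or_eq.mp hj with hj | hj
        · rw [h j hj, psi_basisPoly_of_lt (k := k) hj, mul_zero, sub_zero]
        · obtain rfl : j = k := Fin.ext hj
          rw [hq]; ring)
      (by omega)
    exact ⟨p + scal n q * basisPoly k, by rw [map_add, hp, sub_add_cancel]⟩

lemma range_psi : Set.range (psi n) = (HGQe n : Set (Fin (2*n) → Rr n)) := by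
  ext f
  constructor
  · rintro ⟨p, rfl⟩
    exact psi_mem p
  · exact fun hf => exists_psi_eq_of_vanishing (m := 0) hf (by simp)

lemma ker_psi (hn : 2 ≤ n) : RingHom.ker (psi n) = Ideal.span (relSet' n) := by
  refine le_antisymm (fun p hp => ?_) span_relSet'_le_ker
  obtain ⟨c, hc⟩ := mem_spanned.mp (mem_spanned_all hn p)
  have h := span_relSet'_le_ker hc
  rw [RingHom.mem_ker] at h hp
  rw [map_sub, hp, zero_sub, neg_eq_zero] at h
  simpa [eq_zero_of_psi_sum_eq_zero h] using hc

end Triangularity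

/-- each of M_v, Δ'_K, X lies in H*(GQ_{2n−2}); ψ is surjective onto
H*(GQ_{2n−2}) with kernel 𝔦'; consequently P'/𝔦' ≅ H*(GQ_{2n−2}) as rings. -/
theorem stmt17 (n : ℕ) (hn : 2 ≤ n) :
    (∀ v : Fin (2*n), Mv v ∈ HGQe n) ∧
    (∀ K : Finset (Fin (2*n)), K.Nonempty → indep K → Del' K ∈ HGQe n) ∧
    Qf ∈ HGQe n ∧
    Set.range (psi n) = (HGQe n : Set (Fin (2*n) → Rr n)) ∧
    RingHom.ker (psi n) = Ideal.span (relSet' n) ∧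
    Nonempty ((MvPolynomial (GenIdx n) ℤ ⧸ Ideal.span (relSet' n)) ≃+* HGQe n) := by
  refine ⟨Mv_mem, fun K _ hK => Del'_mem hK, Qf_mem, range_psi, ker_psi hn, ⟨?_⟩⟩
  have h : (psi n).range = HGQe n := SetLike.coe_injective (by simpa using range_psi)
  exact (Ideal.quotEquivOfEq (ker_psi hn).symm).trans
    ((psi n).quotientKerEquivRange.trans (RingEquiv.subringCongr h))

end
end

section
/- Let m ≥ 1 be an integer. The ring ℤ[t_p, t_q, a]/⟨t_p·t_q, m·a − t_p − t_q⟩ is isomorphic to the ring S_m = {(f,g) ∈ ℤ[a] × ℤ[a] : m·a divides f − g in ℤ[a]} (a subring of ℤ[a] × ℤ[a] with componentwise operations); an isomorphism is induced by t_p ↦ (m·a, 0), t_q ↦ (0, m·a), and a ↦ (a, a). -/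
open MvPolynomial

noncomputable section

/-- The ring S_m = {(f,g) ∈ ℤ[a] × ℤ[a] : m·a ∣ f − g}, a subring of ℤ[a] × ℤ[a] with
componentwise operations. -/
def Sm (m : ℕ) : Subring (Polynomial ℤ × Polynomial ℤ) where
  carrier := {p | (m : Polynomial ℤ) * Polynomial.X ∣ p.1 - p.2}
  zero_mem' := by simp
  one_mem' := by simp
  add_mem' := by
    intro a b ha hb
    show (m : Polynomial ℤ) * Polynomial.X ∣ (a + b).1 - (a + b).2
    have e : (a + b).1 - (a + b).2 = (a.1 - a.2) + (b.1 - b.2) := by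
      simp only [Prod.fst_add, Prod.snd_add]; ring
    rw [e]; exact dvd_add ha hb
  neg_mem' := by
    intro a ha
    show (m : Polynomial ℤ) * Polynomial.X ∣ (-a).1 - (-a).2
    have e : (-a).1 - (-a).2 = -(a.1 - a.2) := by
      simp only [Prod.fst_neg, Prod.snd_neg]; ring
    rw [e]; exact dvd_neg.mpr ha
  mul_mem' := by
    intro a b ha hb
    show (m : Polynomial ℤ) * Polynomial.X ∣ (a * b).1 - (a * b).2
    have e : (a * b).1 - (a * b).2 = a.1 * (b.1 - b.2) + (a.1 - a.2) * b.2 := by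
      simp only [Prod.fst_mul, Prod.snd_mul]; ring
    rw [e]; exact dvd_add (hb.mul_left _) (ha.mul_right _)

/-- The homomorphism ℤ[t_p, t_q, a] → ℤ[a] × ℤ[a] with t_p ↦ (m·a, 0), t_q ↦ (0, m·a)
and a ↦ (a, a). -/
noncomputable def psi19 (m : ℕ) : MvPolynomial (Fin 3) ℤ →+* Polynomial ℤ × Polynomial ℤ :=
  (MvPolynomial.aeval
    ![(((m : Polynomial ℤ) * Polynomial.X : Polynomial ℤ), (0 : Polynomial ℤ)),
      ((0 : Polynomial ℤ), ((m : Polynomial ℤ) * Polynomial.X : Polynomial ℤ)),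
      ((Polynomial.X : Polynomial ℤ), (Polynomial.X : Polynomial ℤ))]).toRingHom

/-- The ideal ⟨t_p·t_q, m·a − t_p − t_q⟩ of ℤ[t_p, t_q, a]. -/
def rel19 (m : ℕ) : Ideal (MvPolynomial (Fin 3) ℤ) :=
  Ideal.span {(X 0 : MvPolynomial (Fin 3) ℤ) * X 1,
    (m : MvPolynomial (Fin 3) ℤ) * X 2 - X 0 - X 1}

theorem psi19_X_zero (m : ℕ) : psi19 m (X 0) = ((m : Polynomial ℤ) * Polynomial.X, 0) := by
  simp [psi19]

theorem psi19_X_one (m : ℕ) : psi19 m (X 1) = (0, (m : Polynomial ℤ) * Polynomial.X) := by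
  simp [psi19]

theorem psi19_X_two (m : ℕ) : psi19 m (X 2) = (Polynomial.X, Polynomial.X) := by
  simp [psi19]

theorem rel19_le_ker_psi19 (m : ℕ) : rel19 m ≤ RingHom.ker (psi19 m) := by
  rw [rel19, Ideal.span_le]
  rintro x (rfl | rfl) <;>
    simp [RingHom.mem_ker, psi19_X_zero, psi19_X_one, psi19_X_two, Prod.ext_iff]

theorem psi19_aeval_X_two (m : ℕ) (f : Polynomial ℤ) :
    psi19 m (Polynomial.aeval (X 2) f) = (f, f) := by
  induction f using Polynomial.induction_on' with
  | add p q hp hq => simp [hp, hq]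
  | monomial n c =>
    simp [psi19_X_two, ← Polynomial.C_mul_X_pow_eq_monomial, Prod.ext_iff]

theorem psi19_normal_form (m : ℕ) (f g : Polynomial ℤ) :
    psi19 m (Polynomial.aeval (X 2) f + Polynomial.aeval (X 2) g * X 0) =
      (f + g * ((m : Polynomial ℤ) * Polynomial.X), f) := by
  simp [psi19_aeval_X_two, psi19_X_zero]

/-- Modulo the relations, every polynomial is of the form `f(a) + g(a) t_p`. -/
theorem exists_sub_normal_form_mem_rel19 (m : ℕ) (F : MvPolynomial (Fin 3) ℤ) :
    ∃ f g : Polynomial ℤ,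
      F - (Polynomial.aeval (X 2) f + Polynomial.aeval (X 2) g * X 0) ∈ rel19 m := by
  induction F using MvPolynomial.induction_on with
  | C c => exact ⟨Polynomial.C c, 0, by simp⟩
  | add p q hp hq =>
    obtain ⟨f, g, h⟩ := hp
    obtain ⟨f', g', h'⟩ := hq
    refine ⟨f + f', g + g', ?_⟩
    convert add_mem h h' using 1
    simp only [map_add]
    ring
  | mul_X p i hp =>
    obtain ⟨f, g, h⟩ := hp
    have h₁ : (X 0 : MvPolynomial (Fin 3) ℤ) * X 1 ∈ rel19 m :=
      Ideal.subset_span (by simp)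
    have h₂ : (m : MvPolynomial (Fin 3) ℤ) * X 2 - X 0 - X 1 ∈ rel19 m :=
      Ideal.subset_span (by simp)
    have hi : i = 0 ∨ i = 1 ∨ i = 2 := by fin_cases i <;> simp
    rcases hi with rfl | rfl | rfl
    · refine ⟨0, f + g * ((m : Polynomial ℤ) * Polynomial.X), ?_⟩
      convert sub_mem (Ideal.mul_mem_right (X 0) _ h)
        (Ideal.mul_mem_left _ (Polynomial.aeval (X 2) g)
          (add_mem (Ideal.mul_mem_left _ (X 0) h₂) h₁)) using 1
      simp only [map_add, map_mul, map_zero, map_natCast, Polynomial.aeval_X]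
      ring
    · refine ⟨f * ((m : Polynomial ℤ) * Polynomial.X), -f, ?_⟩
      convert add_mem (Ideal.mul_mem_right (X 1) _ h)
        (sub_mem (Ideal.mul_mem_left _ (Polynomial.aeval (X 2) g) h₁)
          (Ideal.mul_mem_left _ (Polynomial.aeval (X 2) f) h₂)) using 1
      simp only [map_neg, map_mul, map_natCast, Polynomial.aeval_X]
      ring
    · refine ⟨f * Polynomial.X, g * Polynomial.X, ?_⟩
      convert Ideal.mul_mem_right (X 2) _ h using 1
      simp only [map_mul, Polynomial.aeval_X]
      ring

theorem exists_psi19_eq (m : ℕ) (F : MvPolynomial (Fin 3) ℤ) :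
    ∃ f g : Polynomial ℤ,
      F - (Polynomial.aeval (X 2) f + Polynomial.aeval (X 2) g * X 0) ∈ rel19 m ∧
      psi19 m F = (f + g * ((m : Polynomial ℤ) * Polynomial.X), f) := by
  obtain ⟨f, g, h⟩ := exists_sub_normal_form_mem_rel19 m F
  refine ⟨f, g, h, ?_⟩
  rw [← psi19_normal_form, ← sub_eq_zero, ← map_sub]
  exact rel19_le_ker_psi19 m h

theorem range_psi19 (m : ℕ) : (psi19 m).range = Sm m := by
  ext ⟨u, v⟩
  constructor
  · rintro ⟨F, hF⟩
    obtain ⟨f, g, -, h⟩ := exists_psi19_eq m F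
    obtain ⟨hu, hv⟩ := Prod.ext_iff.mp (hF.symm.trans h)
    refine ⟨g, ?_⟩
    linear_combination hu - hv
  · rintro ⟨g, hg⟩
    refine ⟨_, (psi19_normal_form m v g).trans (Prod.ext ?_ rfl)⟩
    linear_combination -hg

theorem ker_psi19 (m : ℕ) (hm : 1 ≤ m) : RingHom.ker (psi19 m) = rel19 m := by
  refine le_antisymm (fun F hF => ?_) (rel19_le_ker_psi19 m)
  obtain ⟨f, g, hmem, h⟩ := exists_psi19_eq m F
  obtain ⟨hg, rfl⟩ := Prod.ext_iff.mp (h.symm.trans hF)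
  have hm' : (m : Polynomial ℤ) ≠ 0 := Nat.cast_ne_zero.mpr (by omega)
  have hg' : g = 0 := by simpa [hm'] using hg
  simpa [hg'] using hmem

/-- for m ≥ 1, ℤ[t_p, t_q, a]/⟨t_p t_q, m·a − t_p − t_q⟩ ≅ S_m, the
isomorphism being induced by t_p ↦ (m·a, 0), t_q ↦ (0, m·a), a ↦ (a, a): this map has
range S_m and kernel ⟨t_p t_q, m·a − t_p − t_q⟩. -/
theorem stmt19 (m : ℕ) (hm : 1 ≤ m) :
    Set.range (psi19 m) = (Sm m : Set (Polynomial ℤ × Polynomial ℤ)) ∧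
    RingHom.ker (psi19 m) = rel19 m ∧
    Nonempty ((MvPolynomial (Fin 3) ℤ ⧸ rel19 m) ≃+* Sm m) := by
  refine ⟨?_, ker_psi19 m hm, ⟨?_⟩⟩
  · rw [← range_psi19, RingHom.coe_range]
  · exact (Ideal.quotEquivOfEq (ker_psi19 m hm).symm).trans
      ((RingHom.quotientKerEquivRange (psi19 m)).trans
        (RingEquiv.subringCongr (range_psi19 m)))

end
end
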